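/- arXiv:2408.05848 — 2 statements merged into one kernel-verified Lean document; each statement's English description precedes it below -/
import Mathlib

section
/- In the Berwald frame setting, if S I = 0 (the Landsberg condition), K is nowhere zero on N, and S K = 0 (the flag curvature is S-invariant), then I = 0 identically on N; i.e., a Landsberg surface with non-zero flag curvature whose flag curvature is S-invariant is Riemannian. -/
/-- Derivative `X f` of a function `f` along a vector field `X`:
`(X f)(p) = df_p(X(p))`. -/
noncomputable def dAlong {E : Type*} [NormedAddCommGroup E] [NormedSpace ℝ E]
    (X : E → E) (f : E → ℝ) : E → ℝ :=
  fun p => fderiv ℝ f p (X p)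

/-- Lie bracket `[X,Y]` of two vector fields. -/
noncomputable def lieB {E : Type*} [NormedAddCommGroup E] [NormedSpace ℝ E]
    (X Y : E → E) : E → E :=
  fun p => fderiv ℝ Y p (X p) - fderiv ℝ X p (Y p)

/-- The Lie bracket acts on functions as the commutator of directional derivatives. -/
lemma fderiv_lieB_apply {E : Type*} [NormedAddCommGroup E] [NormedSpace ℝ E]
    {X Y : E → E} {f : E → ℝ} {p : E} (hX : DifferentiableAt ℝ X p)
    (hY : DifferentiableAt ℝ Y p) (hf : ContDiffAt ℝ 2 f p) :
    fderiv ℝ f p (lieB X Y p) = dAlong X (dAlong Y f) p - dAlong Y (dAlong X f) p := by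
  have hdf : DifferentiableAt ℝ (fderiv ℝ f) p :=
    (hf.fderiv_right (m := 1) (by norm_num)).differentiableAt (by norm_num)
  have hsymm := (hf.isSymmSndFDerivAt (by simp)).eq (X p) (Y p)
  unfold dAlong lieB
  rw [fderiv_clm_apply hdf hY, fderiv_clm_apply hdf hX]
  simp [hsymm]

/-- The derivative along a vector field at `p` depends only on the function near `p`. -/
lemma dAlong_congr_of_eqOn {E : Type*} [NormedAddCommGroup E] [NormedSpace ℝ E]
    {N : Set E} (hN : IsOpen N) (X : E → E) {f g : E → ℝ} (h : Set.EqOn f g N)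
    {p : E} (hp : p ∈ N) : dAlong X f p = dAlong X g p := by
  unfold dAlong
  rw [(h.eventuallyEq_of_mem (hN.mem_nhds hp)).fderiv_eq]

/-- The derivative along any vector field of a function vanishing on an open set is zero. -/
lemma dAlong_eq_zero_of_eqOn_zero {E : Type*} [NormedAddCommGroup E] [NormedSpace ℝ E]
    {N : Set E} (hN : IsOpen N) (X : E → E) {f : E → ℝ} (h : ∀ q ∈ N, f q = 0)
    {p : E} (hp : p ∈ N) : dAlong X f p = 0 := by
  rw [dAlong_congr_of_eqOn hN X (g := fun _ => 0) h hp]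
  simp [dAlong]

/-- In the Berwald frame setting, if `S I = 0` (Landsberg),
`K` is nowhere zero on `N`, and `S K = 0`, then `I = 0` identically on `N`:
a Landsberg surface with non-zero `S`-invariant flag curvature is
Riemannian. -/
theorem statement12
    {E : Type*} [NormedAddCommGroup E] [NormedSpace ℝ E]
    (N : Set E) (hNopen : IsOpen N)
    (S H V C : E → E) (K I : E → ℝ)
    (hS : ContDiffOn ℝ (⊤ : ℕ∞) S N) (hH : ContDiffOn ℝ (⊤ : ℕ∞) H N)
    (hV : ContDiffOn ℝ (⊤ : ℕ∞) V N) (hC : ContDiffOn ℝ (⊤ : ℕ∞) C N)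
    (hK : ContDiffOn ℝ (⊤ : ℕ∞) K N) (hI : ContDiffOn ℝ (⊤ : ℕ∞) I N)
    (hSH : ∀ p ∈ N, lieB S H p = K p • V p)
    (hSV : ∀ p ∈ N, lieB S V p = -(H p))
    (hHV : ∀ p ∈ N, lieB H V p = S p + I p • H p + dAlong S I p • V p)
    (hBianchi : ∀ p ∈ N, dAlong S (dAlong S I) p + dAlong V K p + I p * K p = 0)
    (hLand : ∀ p ∈ N, dAlong S I p = 0)
    (hKne : ∀ p ∈ N, K p ≠ 0)
    (hSK : ∀ p ∈ N, dAlong S K p = 0) :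
    ∀ p ∈ N, I p = 0 := by
  have hdiff {X : E → E} (hX : ContDiffOn ℝ (⊤ : ℕ∞) X N) {p : E} (hp : p ∈ N) :
      DifferentiableAt ℝ X p :=
    (hX.contDiffAt (hNopen.mem_nhds hp)).differentiableAt (by simp)
  have hdiff' {f : E → ℝ} (hf : ContDiffOn ℝ (⊤ : ℕ∞) f N) {p : E} (hp : p ∈ N) :
      DifferentiableAt ℝ f p :=
    (hf.contDiffAt (hNopen.mem_nhds hp)).differentiableAt (by simp)
  have hK2 {p : E} (hp : p ∈ N) : ContDiffAt ℝ 2 K p :=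
    (hK.contDiffAt (hNopen.mem_nhds hp)).of_le (WithTop.coe_le_coe.mpr (le_top : (2 : ℕ∞) ≤ ⊤))
  have hVK : ∀ p ∈ N, dAlong V K p = -(I p * K p) := fun p hp => by
    have h := hBianchi p hp
    rw [dAlong_eq_zero_of_eqOn_zero hNopen S hLand hp] at h
    linarith
  have hSVK : ∀ p ∈ N, dAlong S (dAlong V K) p = 0 := fun p hp => by
    rw [dAlong_congr_of_eqOn hNopen S (g := fun q => -(I q * K q)) hVK hp]
    have hSI := hLand p hp
    have hSK' := hSK p hp
    unfold dAlong at hSI hSK' ⊢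
    rw [fderiv_fun_neg, fderiv_fun_mul (hdiff' hI hp) (hdiff' hK hp)]
    simp [hSI, hSK']
  have hHK : ∀ p ∈ N, dAlong H K p = 0 := fun p hp => by
    have h := fderiv_lieB_apply (hdiff hS hp) (hdiff hV hp) (hK2 hp)
    rw [hSV p hp, hSVK p hp, dAlong_eq_zero_of_eqOn_zero hNopen V hSK hp, map_neg] at h
    simpa [dAlong] using h
  intro p hp
  have h := fderiv_lieB_apply (hdiff hS hp) (hdiff hH hp) (hK2 hp)
  rw [hSH p hp, dAlong_eq_zero_of_eqOn_zero hNopen S hHK hp,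
    dAlong_eq_zero_of_eqOn_zero hNopen H hSK hp, map_smul] at h
  change K p * dAlong V K p = 0 - 0 at h
  rw [hVK p hp] at h
  simpa [hKne p hp] using h
end

section
/- In the Berwald frame setting, assume additionally that N is connected, that the vector fields S, H, V, C span the tangent space of N at every point, that C K = 0 (K is 0-homogeneous), that S I = 0 (the Landsberg condition), and that K is nowhere zero on N. Then S K = 0 if and only if K is a constant function; moreover, in that case I = 0, i.e. the surface is Riemannian. -/
/-- The Lie bracket acts on functions as the commutator of directional derivatives. -/
theorem dAlong_lieB {E : Type*} [NormedAddCommGroup E] [NormedSpace ℝ E]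
    {X Y : E → E} {f : E → ℝ} {p : E} (hf : ContDiffAt ℝ 2 f p)
    (hX : DifferentiableAt ℝ X p) (hY : DifferentiableAt ℝ Y p) :
    fderiv ℝ f p (lieB X Y p) = dAlong X (dAlong Y f) p - dAlong Y (dAlong X f) p :=
  VectorField.fderiv_apply_lieBracket hf (by simp) hY hX

/-- A function constant on an open set has zero derivative along every vector field there. -/
theorem dAlong_eq_zero_of_eqOn_const {E : Type*} [NormedAddCommGroup E] [NormedSpace ℝ E]
    {N : Set E} (hN : IsOpen N) {f : E → ℝ} {c : ℝ} (hf : ∀ p ∈ N, f p = c) (X : E → E)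
    {p : E} (hp : p ∈ N) : dAlong X f p = 0 := by
  have h : f =ᶠ[nhds p] fun _ => c := Filter.eventually_of_mem (hN.mem_nhds hp) hf
  simp [dAlong, h.fderiv_eq]

/-- In the Berwald frame setting, assume moreover that `N`
is connected, that `S, H, V, C` span the tangent space at every point of
`N`, that `C K = 0` (`K` is 0-homogeneous), that `S I = 0` (Landsberg), and
that `K` is nowhere zero on `N`.  Then `S K = 0` iff `K` is constant;
moreover, in that case `I = 0`, i.e. the surface is Riemannian. -/
theorem statement13
    {E : Type*} [NormedAddCommGroup E] [NormedSpace ℝ E]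
    (N : Set E) (hNopen : IsOpen N)
    (S H V C : E → E) (K I : E → ℝ)
    (hS : ContDiffOn ℝ (⊤ : ℕ∞) S N) (hH : ContDiffOn ℝ (⊤ : ℕ∞) H N)
    (hV : ContDiffOn ℝ (⊤ : ℕ∞) V N) (hC : ContDiffOn ℝ (⊤ : ℕ∞) C N)
    (hK : ContDiffOn ℝ (⊤ : ℕ∞) K N) (hI : ContDiffOn ℝ (⊤ : ℕ∞) I N)
    (hSH : ∀ p ∈ N, lieB S H p = K p • V p)
    (hSV : ∀ p ∈ N, lieB S V p = -(H p))
    (hHV : ∀ p ∈ N, lieB H V p = S p + I p • H p + dAlong S I p • V p)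
    (hBianchi : ∀ p ∈ N, dAlong S (dAlong S I) p + dAlong V K p + I p * K p = 0)
    (hNconn : IsConnected N)
    (hspan : ∀ p ∈ N, Submodule.span ℝ ({S p, H p, V p, C p} : Set E) = ⊤)
    (hCK : ∀ p ∈ N, dAlong C K p = 0)
    (hLand : ∀ p ∈ N, dAlong S I p = 0)
    (hKne : ∀ p ∈ N, K p ≠ 0) :
    ((∀ p ∈ N, dAlong S K p = 0) ↔ ∃ c : ℝ, ∀ p ∈ N, K p = c)
    ∧ ((∀ p ∈ N, dAlong S K p = 0) → ∀ p ∈ N, I p = 0) := by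
  have hKp : ∀ p ∈ N, ContDiffAt ℝ 2 K p := fun p hp =>
    (hK.contDiffAt (hNopen.mem_nhds hp)).of_le (WithTop.coe_le_coe.2 le_top)
  have diffVec {X : E → E} (hX : ContDiffOn ℝ (⊤ : ℕ∞) X N) {p : E} (hp : p ∈ N) :
      DifferentiableAt ℝ X p :=
    (hX.contDiffAt (hNopen.mem_nhds hp)).differentiableAt (by simp)
  have diffFun {f : E → ℝ} (hf : ContDiffOn ℝ (⊤ : ℕ∞) f N) {p : E} (hp : p ∈ N) :
      DifferentiableAt ℝ f p :=
    (hf.contDiffAt (hNopen.mem_nhds hp)).differentiableAt (by simp)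
  have hVK : ∀ p ∈ N, dAlong V K p = -(I p * K p) := fun p hp => by
    have h := hBianchi p hp
    rw [dAlong_eq_zero_of_eqOn_const hNopen hLand S hp] at h
    linarith
  have hSK_HK (hSK : ∀ p ∈ N, dAlong S K p = 0) : ∀ p ∈ N, dAlong H K p = 0 := by
    intro p hp
    have h := dAlong_lieB (hKp p hp) (diffVec hS hp) (diffVec hV hp)
    rw [hSV p hp, dAlong_eq_zero_of_eqOn_const hNopen hSK V hp] at h
    have hloc : dAlong V K =ᶠ[nhds p] fun q => -(I q * K q) :=
      Filter.eventually_of_mem (hNopen.mem_nhds hp) hVK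
    have hSVK : dAlong S (dAlong V K) p = -(I p * dAlong S K p + K p * dAlong S I p) := by
      rw [dAlong, hloc.fderiv_eq, fderiv_fun_neg, fderiv_fun_mul (diffFun hI hp) (diffFun hK hp)]
      simp [dAlong]
    rw [hSVK, hSK p hp, hLand p hp, map_neg] at h
    simpa [dAlong] using h
  have hSK_VK (hSK : ∀ p ∈ N, dAlong S K p = 0) : ∀ p ∈ N, dAlong V K p = 0 := by
    intro p hp
    have h := dAlong_lieB (hKp p hp) (diffVec hS hp) (diffVec hH hp)
    rw [hSH p hp, dAlong_eq_zero_of_eqOn_const hNopen hSK H hp,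
      dAlong_eq_zero_of_eqOn_const hNopen (hSK_HK hSK) S hp] at h
    simpa [dAlong, hKne p hp] using h
  refine ⟨⟨fun hSK => ?_, fun ⟨c, hc⟩ p hp => dAlong_eq_zero_of_eqOn_const hNopen hc S hp⟩,
    fun hSK p hp => ?_⟩
  · refine hNopen.exists_is_const_of_fderiv_eq_zero hNconn.isPreconnected
      (fun p hp => (diffFun hK hp).differentiableWithinAt) fun p hp => ?_
    have hspan_le : Submodule.span ℝ {S p, H p, V p, C p} ≤ (fderiv ℝ K p).ker := by
      rw [Submodule.span_le]
      rintro _ (rfl | rfl | rfl | rfl)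
      exacts [hSK p hp, hSK_HK hSK p hp, hSK_VK hSK p hp, hCK p hp]
    rw [hspan p hp] at hspan_le
    ext v
    exact hspan_le (Submodule.mem_top (x := v))
  · simpa [hSK_VK hSK p hp, hKne p hp] using hVK p hp
end
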